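/- Blumenthal's zero-one law: Let (B_t)_{t∈ℝ≥0} be a Brownian motion on a probability space (Ω, 𝓕, P), and let (𝓕_t)_{t∈ℝ≥0} be its canonical filtration, 𝓕_t = σ(B_s : s ≤ t). Then the σ-algebra ⋂_{t > 0} 𝓕_t is P-trivial: every event A ∈ ⋂_{t>0} 𝓕_t satisfies P(A) = 0 or P(A) = 1. -/

import Mathlib

open MeasureTheory ProbabilityTheory NNReal

/-- A real-valued stochastic process indexed by `ℝ≥0` is a Brownian motion if almost surely its
paths are continuous, and every finite-dimensional marginal `(X (t 1), …, X (t n))` is a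
centered multivariate Gaussian vector with covariance `cov (X (t i), X (t j)) = min (t i) (t j)`,
which is expressed through the one-dimensional laws of all linear combinations: for every
`a : Fin n → ℝ`, the law of `∑ i, a i * X (t i)` is the real Gaussian measure with mean `0` and
variance `∑ i, ∑ j, a i * a j * min (t i) (t j)`. -/
def IsBrownian {Ω : Type*} [MeasurableSpace Ω] (X : ℝ≥0 → Ω → ℝ) (P : Measure Ω) : Prop :=
  (∀ᵐ ω ∂P, Continuous fun t => X t ω) ∧
  ∀ (n : ℕ) (t : Fin n → ℝ≥0) (a : Fin n → ℝ),
    P.map (fun ω => ∑ i, a i * X (t i) ω) =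
      gaussianReal 0 (∑ i, ∑ j, a i * a j * (min (t i) (t j) : ℝ)).toNNReal


theorem gaussianProcess_of_isBrownian {Ω : Type*} [MeasurableSpace Ω]
    {P : Measure Ω} [IsProbabilityMeasure P] {B : ℝ≥0 → Ω → ℝ}
    (hmeas : ∀ t, Measurable (B t)) (hB : IsBrownian B P) : IsGaussianProcess B P := by
  classical
  refine ⟨fun I => ⟨⟨fun L => ?_⟩⟩⟩
  have hm : Measurable (fun ω ↦ I.restrict (B · ω)) := by
    refine measurable_pi_lambda _ fun i => hmeas _
  have hLm : Measurable L := L.continuous.measurable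
  obtain ⟨v, hv⟩ : ∃ v, (P.map (fun ω ↦ I.restrict (B · ω))).map L = gaussianReal 0 v := by
    rw [Measure.map_map hLm hm]
    refine ⟨_, Eq.trans ?_ (hB.2 I.card (fun i => (I.equivFin.symm i : ℝ≥0))
      (fun i => L (Pi.single (I.equivFin.symm i) 1)))⟩
    congr 1
    ext ω
    rw [I.equivFin.symm.sum_comp (fun i : I => L (Pi.single i 1) * B i ω)]
    simp only [Function.comp]
    conv_lhs => rw [pi_eq_sum_univ' (I.restrict (B · ω)), map_sum]
    refine Finset.sum_congr rfl fun i _ => ?_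
    rw [map_smul, smul_eq_mul, mul_comm]
    rfl
  set μ := P.map (fun ω ↦ I.restrict (B · ω))
  have h1 : μ[L] = 0 := by
    have := integral_map (μ := μ) hLm.aemeasurable (f := fun x : ℝ => x) (by fun_prop)
    rw [← this, hv, integral_id_gaussianReal]
  have h2 : Var[L; μ] = v := by
    have := variance_map (μ := μ) (X := fun x : ℝ => x) (Y := L) (by fun_prop) hLm.aemeasurable
    rw [hv] at this
    rw [variance_fun_id_gaussianReal] at this
    rw [this]; rfl
  rw [hv, h1, h2]; simp

theorem preBrownian_of_isBrownian {Ω : Type*} [MeasurableSpace Ω]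
    {P : Measure Ω} [IsProbabilityMeasure P] {B : ℝ≥0 → Ω → ℝ}
    (hmeas : ∀ t, Measurable (B t)) (hB : IsBrownian B P) : IsPreBrownianReal B P := by
  have hG := gaussianProcess_of_isBrownian hmeas hB
  have hL2 t : MemLp (B t) 2 P := (hG.hasGaussianLaw_eval t).memLp_two
  have h1 t : P.map (B t) = gaussianReal 0 t := by
    have := hB.2 1 (fun _ => t) (fun _ => 1)
    simpa using this
  have h2 s t : s ≤ t → P.map (B s + B t) = gaussianReal 0 (3 * s + t) := by
    intro hst
    have := hB.2 2 ![s, t] ![1, 1]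
    simp [Fin.sum_univ_two, hst] at this
    change P.map (fun ω => B s ω + B t ω) = _
    rw [this]
    congr 1
    ext
    rw [Real.coe_toNNReal _ (by positivity)]
    push_cast; ring
  have var (X : Ω → ℝ) (v : ℝ≥0) (hX : Measurable X) (h : P.map X = gaussianReal 0 v) :
      Var[X; P] = v := by
    have := variance_map (μ := P) (X := fun x : ℝ => x) (Y := X) (by fun_prop) hX.aemeasurable
    rw [h] at this
    rw [variance_fun_id_gaussianReal] at this
    rw [this]; rfl
  refine hG.isPreBrownianReal_of_covariance (fun t => ?_) fun s t hst => ?_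
  · have := integral_map (μ := P) (hmeas t).aemeasurable (f := fun x : ℝ => x) (by fun_prop)
    rw [← this, h1, integral_id_gaussianReal]
  · have h := variance_add (hL2 s) (hL2 t)
    rw [var _ _ (hmeas s) (h1 s), var _ _ (hmeas t) (h1 t),
      var _ _ ((hmeas s).add (hmeas t)) (h2 s t hst)] at h
    push_cast at h
    linarith

theorem indep_shift_integral {Ω : Type*} [MeasurableSpace Ω]
    {P : Measure Ω} [IsProbabilityMeasure P] {B : ℝ≥0 → Ω → ℝ}
    (hmeas : ∀ t, Measurable (B t)) (hB : IsPreBrownianReal B P) (ε : ℝ≥0) (A : Set Ω)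
    (hA : MeasurableSet[⨆ (s : ℝ≥0) (_ : s ≤ ε), MeasurableSpace.comap (B s) inferInstance] A)
    (I : Finset ℝ≥0) (f : BoundedContinuousFunction (I → ℝ) ℝ) :
    ∫ ω in A, f (fun t => B (ε + t) ω - B ε ω) ∂P =
      P.real A * ∫ ω, f (fun t => B (ε + t) ω - B ε ω) ∂P := by
  have hle : (⨆ (s : ℝ≥0) (_ : s ≤ ε), MeasurableSpace.comap (B s) inferInstance) ≤
      MeasurableSpace.comap (fun ω (t : Set.Iic ε) ↦ B t ω) inferInstance := by
    refine iSup₂_le fun s hs => ?_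
    rintro _ ⟨U, hU, rfl⟩
    exact ⟨(fun x => x ⟨s, hs⟩) ⁻¹' U, measurable_pi_apply _ hU, rfl⟩
  obtain ⟨S, hS, rfl⟩ := hle _ hA
  have hAm : MeasurableSet ((fun ω (t : Set.Iic ε) ↦ B t ω) ⁻¹' S) :=
    measurable_pi_lambda _ (fun t => hmeas _) hS
  have hfm : Measurable f := f.continuous.measurable
  have hind := (hB.indepFun_shift ε).symm.comp (φ := S.indicator (1 : (Set.Iic ε → ℝ) → ℝ))
    (ψ := fun x => f (fun t : I => x t)) (measurable_one.indicator hS) (by fun_prop)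
  have := hind.integral_fun_mul_eq_mul_integral
    ((measurable_one.indicator hS).comp
      (measurable_pi_lambda _ (fun t => hmeas _))).aestronglyMeasurable
    (hfm.comp (measurable_pi_lambda _
      fun t => (hmeas _).sub (hmeas _))).aestronglyMeasurable
  rw [← integral_indicator hAm]
  simp only [Function.comp_def] at this
  have hP := integral_indicator_one (μ := P) hAm
  rw [← hP]
  refine Eq.trans ?_ this
  refine integral_congr_ae (Filter.Eventually.of_forall fun ω => ?_)
  by_cases h : (fun t : Set.Iic ε => B t ω) ∈ S <;> simp [Set.indicator, h]

theorem blumenthal_zero_one_law {Ω : Type*} [MeasurableSpace Ω]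
    {P : Measure Ω} [IsProbabilityMeasure P] {B : ℝ≥0 → Ω → ℝ}
    (hmeas : ∀ t, Measurable (B t)) (hB : IsBrownian B P) :
    ∀ A : Set Ω,
      MeasurableSet[⨅ (t : ℝ≥0) (_ : 0 < t),
        ⨆ (s : ℝ≥0) (_ : s ≤ t), MeasurableSpace.comap (B s) inferInstance] A →
      P A = 0 ∨ P A = 1 := by
  intro A hA
  have hpre := preBrownian_of_isBrownian hmeas hB
  have hA' (t : ℝ≥0) (ht : 0 < t) :
      MeasurableSet[⨆ (s : ℝ≥0) (_ : s ≤ t), MeasurableSpace.comap (B s) inferInstance] A :=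
    (iInf₂_le (f := fun (t : ℝ≥0) (_ : 0 < t) =>
      ⨆ (s : ℝ≥0) (_ : s ≤ t), MeasurableSpace.comap (B s) inferInstance) t ht :
      (⨅ (t : ℝ≥0) (_ : 0 < t), ⨆ (s : ℝ≥0) (_ : s ≤ t),
        MeasurableSpace.comap (B s) inferInstance) ≤
      ⨆ (s : ℝ≥0) (_ : s ≤ t), MeasurableSpace.comap (B s) inferInstance) A hA
  have hAm : MeasurableSet A :=
    (iSup₂_le fun s _ => (hmeas s).comap_le :
      (⨆ (s : ℝ≥0) (_ : s ≤ 1), MeasurableSpace.comap (B s) inferInstance) ≤ _) A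
      (hA' 1 one_pos)
  have hI := indicator_indepFun_process_of_bcf (P := P) (X := B) hAm.nullMeasurableSet
    (fun s => (hmeas s).aemeasurable) (fun I f => by
      have hfm : Measurable f := f.continuous.measurable
      have hlim : ∀ᵐ ω ∂P, Filter.Tendsto
          (fun n : ℕ => f (fun t : I => B (1 / ((n : ℝ≥0) + 1) + t) ω - B (1 / ((n : ℝ≥0) + 1)) ω))
          Filter.atTop (nhds (f (fun t : I => B t ω))) := by
        filter_upwards [hB.1, hpre.eval_zero_ae_eq_zero] with ω hc h0
        have hε : Filter.Tendsto (fun n : ℕ => 1 / ((n : ℝ≥0) + 1)) Filter.atTop (nhds 0) :=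
          tendsto_one_div_add_atTop_nhds_zero_nat
        have hcont : Continuous
            (fun ε : ℝ≥0 => f (fun t : I => B (ε + t) ω - B ε ω)) := by
          refine f.continuous.comp (continuous_pi fun t => ?_)
          exact (hc.comp (continuous_id.add continuous_const)).sub hc
        have := (hcont.tendsto 0).comp hε
        simpa [h0, Function.comp_def] using this
      have hmn (n : ℕ) : Measurable (fun ω =>
          f (fun t : I => B (1 / ((n : ℝ≥0) + 1) + t) ω - B (1 / ((n : ℝ≥0) + 1)) ω)) :=
        hfm.comp (measurable_pi_lambda _ fun t => (hmeas _).sub (hmeas _))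
      have L1 := tendsto_integral_of_dominated_convergence (μ := P.restrict A) (fun _ => ‖f‖)
        (fun n => (hmn n).aestronglyMeasurable) (integrable_const _)
        (fun n => Filter.Eventually.of_forall fun ω => f.norm_coe_le_norm _)
        (ae_restrict_of_ae hlim)
      have L2 := tendsto_integral_of_dominated_convergence (μ := P) (fun _ => ‖f‖)
        (fun n => (hmn n).aestronglyMeasurable) (integrable_const _)
        (fun n => Filter.Eventually.of_forall fun ω => f.norm_coe_le_norm _) hlim
      refine tendsto_nhds_unique L1 ((L2.const_mul (P.real A)).congr fun n => ?_)
      exact (indep_shift_integral hmeas hpre _ A (hA' _ (by positivity)) I f).symm)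
  have hS := IndepFun.singleton_indepSets_of_indicator hI
  rw [IndepSets_iff] at hS
  have hle : (⨆ (s : ℝ≥0) (_ : s ≤ 1), MeasurableSpace.comap (B s) inferInstance) ≤
      MeasurableSpace.comap (fun ω t ↦ B t ω) inferInstance := by
    refine iSup₂_le fun s hs => ?_
    rintro _ ⟨U, hU, rfl⟩
    exact ⟨(fun x => x s) ⁻¹' U, measurable_pi_apply _ hU, rfl⟩
  refine measure_eq_zero_or_one_of_indepSet_self
    ((indepSet_iff_measure_inter_eq_mul hAm hAm P).2 (hS A A rfl (hle _ (hA' 1 one_pos))))
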